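/- Let H=(V,E*) be a finite simple connected hypergraph with V={v_1,…,v_k} and E*=(e_1,…,e_r) satisfying e_1 ∪ … ∪ e_r = V. If H is both s-uniform and unimodular, then there exists a polynomial M(x) with integer coefficients such that (1−x)^{k+1} · Ehr(P(H),x) = M(x) as formal power series, and M is palindromic of degree exactly k−s. -/

import Mathlib

open Polynomial PowerSeries Pointwise

/-- The hypergraph polytope `P(H)` of a hypergraph with vertex set `Fin k` and
hyperedges `E 1, …, E r`: all nonnegative points with `Σ_{j ∈ e} x j ≤ 1` for
every hyperedge `e`. -/
def hypergraphPolytope {k r : ℕ} (E : Fin r → Finset (Fin k)) : Set (Fin k → ℝ) :=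
  {x | (∀ i, 0 ≤ x i) ∧ ∀ i : Fin r, ∑ j ∈ E i, x j ≤ 1}

/-- A hypergraph is simple if no hyperedge is contained in another (distinct) one. -/
def HypSimple {k r : ℕ} (E : Fin r → Finset (Fin k)) : Prop :=
  ∀ i j, E i ⊆ E j → i = j

/-- A hypergraph is connected if any two vertices are joined by a path of hyperedges:
the reflexive-transitive closure of "lie in a common hyperedge" relates all pairs. -/
def HypConnected {k r : ℕ} (E : Fin r → Finset (Fin k)) : Prop :=
  ∀ u v : Fin k, Relation.ReflTransGen (fun a b => ∃ i, a ∈ E i ∧ b ∈ E i) u v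

/-- The incidence matrix of a hypergraph: `A i j = 1` iff vertex `j` lies in hyperedge `i`. -/
def incidenceMatrix {k r : ℕ} (E : Fin r → Finset (Fin k)) : Matrix (Fin r) (Fin k) ℚ :=
  Matrix.of fun i j => if j ∈ E i then 1 else 0

/-- A matrix is totally unimodular if every square submatrix has determinant `-1`, `0` or `1`. -/
def TotUnimodular {r k : ℕ} (A : Matrix (Fin r) (Fin k) ℚ) : Prop :=
  ∀ (n : ℕ) (f : Fin n → Fin r) (g : Fin n → Fin k),
    Function.Injective f → Function.Injective g →
      (A.submatrix f g).det = -1 ∨ (A.submatrix f g).det = 0 ∨ (A.submatrix f g).det = 1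

/-- `ehr P n` is the number of lattice points in the `n`-th dilate `nP` of `P`. -/
noncomputable def ehr {V : Type*} (P : Set (V → ℝ)) (n : ℕ) : ℕ :=
  Set.ncard {m : V → ℤ | (fun i => (m i : ℝ)) ∈ (n : ℝ) • P}

/-- The Ehrhart series `Ehr(P, x) = Σ_{n ≥ 0} ehr(P,n) xⁿ` as a formal power series over `ℚ`. -/
noncomputable def ehrSeries {V : Type*} (P : Set (V → ℝ)) : PowerSeries ℚ :=
  PowerSeries.mk fun n => (ehr P n : ℚ)

section abs
set_option linter.unusedSectionVars false
variable {σ ι : Type} [Fintype σ] [Fintype ι]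

/-- real pairing of an integer form with a real vector -/
def rv (φ : σ → ℤ) (w : σ → ℝ) : ℝ := ∑ j, (φ j : ℝ) * w j

theorem rv_cast (φ x : σ → ℤ) : rv φ (fun j => (x j : ℝ)) = ((φ ⬝ᵥ x : ℤ) : ℝ) := by
  simp [rv, dotProduct]

theorem rv_neg (φ : σ → ℤ) (w : σ → ℝ) : rv φ (-w) = - rv φ w := by
  simp [rv]

/-- the shifted direction `w - c v` -/
def shiftDir (w : σ → ℝ) (v : σ → ℤ) (c : ℝ) : σ → ℝ := fun j => w j - c * (v j : ℝ)

theorem rv_shift (φ : σ → ℤ) (w : σ → ℝ) (v : σ → ℤ) (c : ℝ) :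
    rv φ (shiftDir w v c) = rv φ w - c * ((φ ⬝ᵥ v : ℤ) : ℝ) := by
  simp only [rv, shiftDir, dotProduct, mul_sub, Finset.sum_sub_distrib]
  push_cast
  rw [Finset.mul_sum]
  congr 1
  apply Finset.sum_congr rfl
  intros; ring

theorem shiftDir_neg (w : σ → ℝ) (v : σ → ℤ) (c : ℝ) :
    shiftDir (-w) v (-c) = - shiftDir w v c := by
  ext j; simp [shiftDir]; ring

/-- lattice points of height `n` in the half-open cone given by direction `w`. -/
def conePts (e : ι → σ → ℤ) (ht : σ → ℤ) (w : σ → ℝ) (n : ℤ) : Set (σ → ℤ) :=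
  {x | ht ⬝ᵥ x = n ∧ ∀ l, (0 < e l ⬝ᵥ x ∨ (e l ⬝ᵥ x = 0 ∧ 0 ≤ rv (e l) w)) ∧
    (rv (e l) w = 0 → e l ⬝ᵥ x = 0)}

/-- a good apex for the face of `w`. -/
def GoodV (e : ι → σ → ℤ) (ht : σ → ℤ) (w : σ → ℝ) (v : σ → ℤ) : Prop :=
  ht ⬝ᵥ v = 1 ∧ ∀ l, (e l ⬝ᵥ v = 0 ∨ e l ⬝ᵥ v = 1) ∧ (rv (e l) w = 0 → e l ⬝ᵥ v = 0)

open Classical in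
/-- the set of values of `w` on facets away from `v`. -/
noncomputable def vals (e : ι → σ → ℤ) (w : σ → ℝ) (v : σ → ℤ) : Finset ℝ :=
  (Finset.univ.filter (fun l => e l ⬝ᵥ v = 1)).image (fun l => rv (e l) w)

theorem mem_vals {e : ι → σ → ℤ} {w : σ → ℝ} {v : σ → ℤ} {c : ℝ} :
    c ∈ vals e w v ↔ ∃ l, e l ⬝ᵥ v = 1 ∧ rv (e l) w = c := by
  simp [vals]

theorem vals_neg (e : ι → σ → ℤ) (w : σ → ℝ) (v : σ → ℤ) :
    vals e (-w) v = (vals e w v).map (Equiv.neg ℝ).toEmbedding := by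
  ext c
  simp only [mem_vals, rv_neg, Finset.mem_map]
  constructor
  · rintro ⟨l, h1, h2⟩
    exact ⟨rv (e l) w, ⟨l, h1, rfl⟩, by simpa using h2⟩
  · rintro ⟨c, ⟨l, h1, h2⟩, rfl⟩
    exact ⟨l, h1, by simp [h2]⟩

noncomputable def stepA (c : ℝ) : ℤ := if 0 < c then 0 else 1

/-- pieces of the decomposition -/
def piece (e : ι → σ → ℤ) (ht : σ → ℤ) (w : σ → ℝ) (v : σ → ℤ) (n : ℤ) (c : ℝ) :
    Set (σ → ℤ) := {x | x - stepA c • v ∈ conePts e ht (shiftDir w v c) (n - stepA c)}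

variable {e : ι → σ → ℤ} {ht : σ → ℤ} {w : σ → ℝ} {v : σ → ℤ}

theorem vals_ne_zero (hv : GoodV e ht w v) {c : ℝ} (hc : c ∈ vals e w v) : c ≠ 0 := by
  rintro rfl
  obtain ⟨l, h1, h2⟩ := mem_vals.1 hc
  have := (hv.2 l).2 h2
  omega

theorem mem_piece {n : ℤ} {c : ℝ} {x : σ → ℤ} (hv : GoodV e ht w v) :
    x ∈ piece e ht w v n c ↔ ht ⬝ᵥ x = n ∧
      ∀ l, (0 < e l ⬝ᵥ x - stepA c * (e l ⬝ᵥ v) ∨ (e l ⬝ᵥ x - stepA c * (e l ⬝ᵥ v) = 0 ∧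
        0 ≤ rv (e l) w - c * ((e l ⬝ᵥ v : ℤ) : ℝ))) ∧
        (rv (e l) w - c * ((e l ⬝ᵥ v : ℤ) : ℝ) = 0 → e l ⬝ᵥ x - stepA c * (e l ⬝ᵥ v) = 0) := by
  simp only [piece, conePts, Set.mem_ofPred_eq, dotProduct_sub, dotProduct_smul, rv_shift, hv.1,
    smul_eq_mul, mul_one, sub_left_inj]

theorem piece_subset {n : ℤ} {c : ℝ} (hv : GoodV e ht w v) (hc : c ∈ vals e w v) :
    piece e ht w v n c ⊆ conePts e ht w n := by
  intro x hx
  rw [mem_piece hv] at hx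
  refine ⟨hx.1, fun l => ?_⟩
  obtain ⟨h1, h2⟩ := hx.2 l
  have hc0 := vals_ne_zero hv hc
  rcases (hv.2 l).1 with h | h
  · simp only [h, mul_zero, sub_zero, Int.cast_zero] at h1 h2
    exact ⟨h1, h2⟩
  · have hne : rv (e l) w ≠ 0 := fun h0 => by have := (hv.2 l).2 h0; omega
    refine ⟨?_, fun h0 => absurd h0 hne⟩
    simp only [h, mul_one, Int.cast_one] at h1
    unfold stepA at h1
    split_ifs at h1 with hp
    · rcases h1 with h1 | h1
      · left; omega
      · right; exact ⟨by omega, by linarith [h1.2]⟩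
    · left; omega

theorem piece_attained {n : ℤ} {c : ℝ} {x : σ → ℤ} (hv : GoodV e ht w v) (hc : c ∈ vals e w v)
    (hx : x ∈ piece e ht w v n c) : ∃ l, e l ⬝ᵥ v = 1 ∧ rv (e l) w = c ∧ e l ⬝ᵥ x = stepA c := by
  rw [mem_piece hv] at hx
  obtain ⟨l, h1, h2⟩ := mem_vals.1 hc
  refine ⟨l, h1, h2, ?_⟩
  have := (hx.2 l).2 (by rw [h1, h2]; simp)
  rw [h1] at this
  omega

theorem piece_lower {n : ℤ} {c : ℝ} {x : σ → ℤ} (hv : GoodV e ht w v)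
    (hx : x ∈ piece e ht w v n c) {l : ι} (hl : e l ⬝ᵥ v = 1) :
    stepA c < e l ⬝ᵥ x ∨ (e l ⬝ᵥ x = stepA c ∧ c ≤ rv (e l) w) := by
  rw [mem_piece hv] at hx
  have := (hx.2 l).1
  rw [hl] at this
  rcases this with h | h
  · left; omega
  · right; exact ⟨by omega, by have := h.2; push_cast at this; linarith⟩

theorem pieces_disjoint {n : ℤ} {c c' : ℝ} {x : σ → ℤ} (hv : GoodV e ht w v)
    (hc : c ∈ vals e w v) (hc' : c' ∈ vals e w v)
    (hx : x ∈ piece e ht w v n c) (hx' : x ∈ piece e ht w v n c') : c = c' := by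
  obtain ⟨l, h1, h2, h3⟩ := piece_attained hv hc hx
  obtain ⟨l', h1', h2', h3'⟩ := piece_attained hv hc' hx'
  have a := piece_lower hv hx h1'
  have b := piece_lower hv hx' h1
  rcases a with a | a <;> rcases b with b | b
  · omega
  · omega
  · omega
  · apply le_antisymm <;> linarith [a.2, b.2]

theorem piece_disjoint_shift {n : ℤ} {c : ℝ} {x : σ → ℤ} (hv : GoodV e ht w v)
    (hc : c ∈ vals e w v)
    (hx : x ∈ piece e ht w v n c) (hx' : x - v ∈ conePts e ht w (n - 1)) : False := by
  obtain ⟨l, h1, h2, h3⟩ := piece_attained hv hc hx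
  have := (hx'.2 l).1
  have hc0 := vals_ne_zero hv hc
  rw [dotProduct_sub, h1, h3, h2] at this
  unfold stepA at this
  split_ifs at this with h
  · omega
  · rcases this with h' | h'
    · omega
    · exact h (lt_of_le_of_ne h'.2 hc0.symm)

theorem shift_subset {n : ℤ} {x : σ → ℤ} (hv : GoodV e ht w v)
    (hx' : x - v ∈ conePts e ht w (n - 1)) : x ∈ conePts e ht w n := by
  obtain ⟨h0, h⟩ := hx'
  rw [dotProduct_sub, hv.1] at h0
  refine ⟨by omega, fun l => ?_⟩
  obtain ⟨h1, h2⟩ := h l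
  rw [dotProduct_sub] at h1 h2
  rcases (hv.2 l).1 with h3 | h3
  · rw [h3, sub_zero] at h1 h2
    exact ⟨h1, h2⟩
  · refine ⟨?_, fun h0 => by have := (hv.2 l).2 h0; omega⟩
    left
    rcases h1 with h1 | h1 <;> omega

theorem cover_pieces {n : ℤ} {x : σ → ℤ} (hv : GoodV e ht w v) (hx : x ∈ conePts e ht w n)
    (hG : ∀ l i, rv (e l) w = rv (e i) w → e l ⬝ᵥ x = e i ⬝ᵥ x)
    (hx' : x - v ∉ conePts e ht w (n - 1)) : ∃ c ∈ vals e w v, x ∈ piece e ht w v n c := by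
  classical
  have hfail : ∃ l, e l ⬝ᵥ v = 1 ∧
      ¬ (0 < e l ⬝ᵥ x - 1 ∨ (e l ⬝ᵥ x - 1 = 0 ∧ 0 ≤ rv (e l) w)) := by
    by_contra hcon
    push Not at hcon
    apply hx'
    refine ⟨by rw [dotProduct_sub, hv.1, hx.1], fun l => ?_⟩
    rw [dotProduct_sub]
    rcases (hv.2 l).1 with h3 | h3
    · rw [h3, sub_zero]; exact hx.2 l
    · rw [h3]
      refine ⟨?_, fun h0 => by have := (hv.2 l).2 h0; omega⟩
      have := hcon l h3
      by_contra h4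
      push Not at h4
      rcases this with h | h
      · omega
      · exact absurd h.2 (not_le.2 (h4.2 h.1))
  obtain ⟨l0, hl0, hf⟩ := hfail
  obtain ⟨i, hi, hmin⟩ := Finset.exists_min_image
    (Finset.univ.filter (fun l => e l ⬝ᵥ v = 1))
    (fun l => toLex ((e l ⬝ᵥ x : ℤ), rv (e l) w)) ⟨l0, by simpa using hl0⟩
  simp only [Finset.mem_filter, Finset.mem_univ, true_and] at hi hmin
  have hc : rv (e i) w ∈ vals e w v := mem_vals.2 ⟨i, hi, rfl⟩
  have hc0 := vals_ne_zero hv hc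
  have hmin' : ∀ l, e l ⬝ᵥ v = 1 →
      (e i ⬝ᵥ x < e l ⬝ᵥ x ∨ (e i ⬝ᵥ x = e l ⬝ᵥ x ∧ rv (e i) w ≤ rv (e l) w)) := by
    intro l hl
    have := hmin l hl
    rw [Prod.Lex.toLex_le_toLex] at this
    exact this
  have ha : e i ⬝ᵥ x = stepA (rv (e i) w) := by
    have h1 := (hx.2 i).1
    have h2 := hmin' l0 hl0
    push Not at hf
    unfold stepA
    split_ifs with hp
    · rcases h2 with h2 | h2
      · rcases h1 with h1 | h1 <;> omega
      · by_contra hne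
        have h3 := hf.2 (by rcases h1 with h1 | h1 <;> omega)
        linarith [h2.2]
    · rcases h1 with h1 | h1
      · rcases h2 with h2 | h2 <;> omega
      · exact absurd (lt_of_le_of_ne h1.2 hc0.symm) hp
  refine ⟨rv (e i) w, hc, ?_⟩
  rw [mem_piece hv]
  refine ⟨hx.1, fun l => ?_⟩
  rw [← ha]
  rcases (hv.2 l).1 with h3 | h3
  · simpa [h3] using hx.2 l
  · simp only [h3, mul_one, Int.cast_one]
    refine ⟨?_, fun h0 => by rw [hG l i (by linarith), sub_self]⟩
    rcases hmin' l h3 with h | h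
    · left; omega
    · right; exact ⟨by omega, by linarith [h.2]⟩

/-- rational forms vanishing on `w` -/
noncomputable def kerW (w : σ → ℝ) : Submodule ℚ (σ → ℚ) := LinearMap.ker (Fintype.linearCombination ℚ w)

def castQ (φ : σ → ℤ) : σ → ℚ := fun j => (φ j : ℚ)

theorem mem_kerW {φ : σ → ℚ} : φ ∈ kerW w ↔ ∑ j, (φ j : ℝ) * w j = 0 := by
  simp [kerW, Fintype.linearCombination_apply, Rat.smul_def]

theorem castQ_mem_kerW {φ : σ → ℤ} : castQ φ ∈ kerW w ↔ rv φ w = 0 := by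
  simp [mem_kerW, castQ, rv]

/-- genericity of `w` in the face spanned by its vanishing facets -/
def Generic (e : ι → σ → ℤ) (w : σ → ℝ) : Prop :=
  kerW w ≤ Submodule.span ℚ ((fun l => castQ (e l)) '' {l | rv (e l) w = 0})

theorem Generic.vanish (hw : Generic e w) {x : σ → ℤ} (hx : ∀ l, rv (e l) w = 0 → e l ⬝ᵥ x = 0)
    {φ : σ → ℚ} (hφ : φ ∈ kerW w) : φ ⬝ᵥ castQ x = 0 := by
  have h := hw hφ
  clear hφ
  induction h using Submodule.span_induction with
  | mem y hy =>
    obtain ⟨l, hl, rfl⟩ := hy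
    have := hx l hl
    have h2 : ((e l ⬝ᵥ x : ℤ) : ℚ) = castQ (e l) ⬝ᵥ castQ x := by simp [dotProduct, castQ]
    simp only
    rw [← h2, this]; simp
  | zero => simp
  | add a b _ _ ha hb => rw [add_dotProduct, ha, hb, add_zero]
  | smul a b _ hb => rw [smul_dotProduct, hb, smul_zero]

theorem Generic.eq_of (hw : Generic e w) {x : σ → ℤ}
    (hx : ∀ l, rv (e l) w = 0 → e l ⬝ᵥ x = 0) (l i : ι) (h : rv (e l) w = rv (e i) w) :
    e l ⬝ᵥ x = e i ⬝ᵥ x := by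
  have h1 : castQ (e l - e i) ∈ kerW w := by
    rw [castQ_mem_kerW]
    simp only [rv, Pi.sub_apply, Int.cast_sub, sub_mul, Finset.sum_sub_distrib] at h ⊢
    linarith
  have h2 := hw.vanish hx h1
  have h3 : (((e l - e i) ⬝ᵥ x : ℤ) : ℚ) = castQ (e l - e i) ⬝ᵥ castQ x := by
    simp [dotProduct, castQ]
  rw [← h3] at h2
  have h4 : (e l - e i) ⬝ᵥ x = 0 := by exact_mod_cast h2
  rw [sub_dotProduct] at h4
  omega

theorem Generic.neg (hw : Generic e w) : Generic e (-w) := by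
  have h1 : kerW (-w) = kerW w := by ext φ; simp [mem_kerW]
  simpa [Generic, rv_neg, h1] using hw

theorem kerW_neg : kerW (-w) = kerW w := by ext φ; simp [mem_kerW]

theorem GoodV.neg (hv : GoodV e ht w v) : GoodV e ht (-w) v := by
  simpa [GoodV, rv_neg] using hv

theorem mem_kerW_shift {c : ℝ} {φ : σ → ℚ} :
    φ ∈ kerW (shiftDir w v c) ↔ ∑ j, (φ j : ℝ) * w j = c * ((φ ⬝ᵥ castQ v : ℚ) : ℝ) := by
  rw [mem_kerW, ← sub_eq_zero (b := c * _)]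
  simp only [shiftDir, mul_sub, Finset.sum_sub_distrib, dotProduct, castQ]
  push_cast
  rw [Finset.mul_sum]
  have : ∀ j, (φ j : ℝ) * (c * v j) = c * (φ j * v j) := fun j => by ring
  simp only [this]

theorem kerW_shift (hw : Generic e w) (hv : GoodV e ht w v) {c : ℝ} {i : ι}
    (hi : e i ⬝ᵥ v = 1) (hc : rv (e i) w = c) :
    kerW (shiftDir w v c) = kerW w ⊔ Submodule.span ℚ {castQ (e i)} := by
  have hiv : castQ (e i) ⬝ᵥ castQ v = 1 := by
    have h2 : ((e i ⬝ᵥ v : ℤ) : ℚ) = castQ (e i) ⬝ᵥ castQ v := by simp [dotProduct, castQ]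
    rw [← h2, hi]; simp
  apply le_antisymm
  · intro φ hφ
    rw [mem_kerW_shift] at hφ
    rw [Submodule.mem_sup]
    refine ⟨φ - (φ ⬝ᵥ castQ v) • castQ (e i), ?_, (φ ⬝ᵥ castQ v) • castQ (e i),
      Submodule.smul_mem _ _ (Submodule.mem_span_singleton_self _), by simp⟩
    rw [mem_kerW]
    simp only [Pi.sub_apply, Pi.smul_apply, smul_eq_mul, Rat.cast_sub, Rat.cast_mul, sub_mul,
      Finset.sum_sub_distrib, hφ, mul_assoc, ← Finset.mul_sum]
    have : ∑ j, ((castQ (e i) j : ℚ) : ℝ) * w j = c := by rw [← hc]; simp [castQ, rv]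
    rw [this]; ring
  · rw [sup_le_iff]
    constructor
    · intro φ hφ
      rw [mem_kerW_shift, hw.vanish (fun l => (hv.2 l).2) hφ, mem_kerW.1 hφ]; simp
    · rw [Submodule.span_singleton_le_iff_mem, castQ_mem_kerW, rv_shift, hi, hc]; simp

theorem Generic.shift (hw : Generic e w) (hv : GoodV e ht w v) {c : ℝ}
    (hc : c ∈ vals e w v) : Generic e (shiftDir w v c) := by
  obtain ⟨i, hi, hci⟩ := mem_vals.1 hc
  unfold Generic
  rw [kerW_shift hw hv hi hci, sup_le_iff]
  constructor
  · refine hw.trans (Submodule.span_mono (Set.image_mono ?_))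
    intro l hl
    have hl' : rv (e l) w = 0 := hl
    show rv (e l) _ = 0
    rw [rv_shift, (hv.2 l).2 hl', hl']; simp
  · apply Submodule.span_mono
    rw [Set.singleton_subset_iff]
    refine ⟨i, ?_, rfl⟩
    show rv (e i) _ = 0
    rw [rv_shift, hi, hci]; simp

theorem finrank_shift (hw : Generic e w) (hv : GoodV e ht w v) {c : ℝ}
    (hc : c ∈ vals e w v) :
    Module.finrank ℚ (kerW (shiftDir w v c)) = Module.finrank ℚ (kerW w) + 1 := by
  have hc0 := vals_ne_zero hv hc
  obtain ⟨i, hi, hci⟩ := mem_vals.1 hc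
  rw [kerW_shift hw hv hi hci]
  have h0 : castQ (e i) ∉ kerW w := by rw [castQ_mem_kerW, hci]; exact hc0
  have hne : castQ (e i) ≠ 0 := fun h => h0 (h ▸ Submodule.zero_mem _)
  have := Submodule.finrank_sup_add_finrank_inf_eq (kerW w) (Submodule.span ℚ {castQ (e i)})
  rw [finrank_span_singleton hne] at this
  have h1 : kerW w ⊓ Submodule.span ℚ {castQ (e i)} = ⊥ := by
    rw [← disjoint_iff, Submodule.disjoint_span_singleton' hne]
    exact h0
  rw [h1] at this
  simpa using this

theorem count_step (hw : Generic e w) (hv : GoodV e ht w v)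
    (hfin : ∀ (w : σ → ℝ) n, (conePts e ht w n).Finite) (n : ℤ) :
    (conePts e ht w n).ncard = (conePts e ht w (n - 1)).ncard +
      ∑ c ∈ vals e w v, (conePts e ht (shiftDir w v c) (n - stepA c)).ncard := by
  classical
  have himg : ∀ (u : σ → ℤ) (S : Set (σ → ℤ)), {x | x - u ∈ S} = (fun y => y + u) '' S := by
    intro u S
    ext x
    constructor
    · intro h; exact ⟨x - u, h, by simp⟩
    · rintro ⟨y, hy, rfl⟩; simpa using hy
  have hcard : ∀ (u : σ → ℤ) (S : Set (σ → ℤ)), {x | x - u ∈ S}.ncard = S.ncard := by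
    intro u S
    rw [himg]; exact Set.ncard_image_of_injective _ (add_left_injective u)
  have hf : ∀ (u : σ → ℤ) (S : Set (σ → ℤ)), S.Finite → {x | x - u ∈ S}.Finite := by
    intro u S hS
    rw [himg]; exact hS.image _
  have hun : conePts e ht w n = {x | x - v ∈ conePts e ht w (n - 1)} ∪
      ⋃ c ∈ vals e w v, piece e ht w v n c := by
    ext x
    simp only [Set.mem_union, Set.mem_iUnion]
    constructor
    · intro hx
      by_cases h : x - v ∈ conePts e ht w (n - 1)
      · left; exact h
      · right
        obtain ⟨c, hc, h⟩ := cover_pieces hv hx (hw.eq_of (fun l => (hx.2 l).2)) h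
        exact ⟨c, hc, h⟩
    · rintro (h | ⟨c, hc, h⟩)
      · exact shift_subset hv h
      · exact piece_subset hv hc h
  have hpf : ∀ c, (piece e ht w v n c).Finite := fun c => hf _ _ (hfin _ _)
  have hbf : ∀ J : Finset ℝ, (⋃ c ∈ J, piece e ht w v n c).Finite := fun J =>
    Set.Finite.biUnion (Finset.finite_toSet J) fun c _ => hpf c
  rw [hun, Set.ncard_union_eq _ (hf _ _ (hfin _ _)) (hbf _), hcard]
  · congr 1
    have : ∀ J ⊆ vals e w v, (⋃ c ∈ J, piece e ht w v n c).ncard =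
        ∑ c ∈ J, (conePts e ht (shiftDir w v c) (n - stepA c)).ncard := by
      intro J
      induction J using Finset.induction_on with
      | empty => simp
      | insert a J ha ih =>
        intro hJ
        rw [Finset.insert_subset_iff] at hJ
        rw [Finset.sum_insert ha, Finset.set_biUnion_insert, Set.ncard_union_eq _ (hpf a)
          (hbf _), ih hJ.2]
        · congr 1
          exact hcard _ _
        · rw [Set.disjoint_left]
          intro x hx hx'
          simp only [Set.mem_iUnion] at hx'
          obtain ⟨c, hc, hx'⟩ := hx'
          exact ha (pieces_disjoint hv hJ.1 (hJ.2 hc) hx hx' ▸ hc)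
    exact this _ (Finset.Subset.refl _)
  · rw [Set.disjoint_left]
    intro x hx hx'
    simp only [Set.mem_iUnion] at hx'
    obtain ⟨c, hc, hx'⟩ := hx'
    exact piece_disjoint_shift hv hc hx' hx

/-- the generating function of the half-open cone -/
noncomputable def serW (e : ι → σ → ℤ) (ht : σ → ℤ) (w : σ → ℝ) : PowerSeries ℤ :=
  PowerSeries.mk fun n => ((conePts e ht w (n : ℤ)).ncard : ℤ)

theorem series_step (hw : Generic e w) (hv : GoodV e ht w v)
    (hfin : ∀ (w : σ → ℝ) n, (conePts e ht w n).Finite)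
    (hneg : ∀ (w : σ → ℝ) n, n < 0 → conePts e ht w n = ∅) :
    (1 - PowerSeries.X) * serW e ht w = ∑ c ∈ vals e w v,
      (if 0 < c then serW e ht (shiftDir w v c) else
        PowerSeries.X * serW e ht (shiftDir w v c)) := by
  ext n
  have hc := count_step hw hv hfin (n : ℤ)
  rw [sub_mul, one_mul, map_sub, map_sum]
  have h1 : ∀ w : σ → ℝ, PowerSeries.coeff n (PowerSeries.X * serW e ht w) =
      ((conePts e ht w ((n : ℤ) - 1)).ncard : ℤ) := by
    intro w
    cases n with
    | zero => simp [hneg w (-1) (by norm_num)]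
    | succ n => rw [PowerSeries.coeff_succ_X_mul]; simp [serW]
  have h2 : ∀ c, PowerSeries.coeff n (if 0 < c then serW e ht (shiftDir w v c) else
        PowerSeries.X * serW e ht (shiftDir w v c)) =
      ((conePts e ht (shiftDir w v c) ((n : ℤ) - stepA c)).ncard : ℤ) := by
    intro c
    unfold stepA
    split_ifs
    · simp [serW]
    · exact h1 _
  simp only [h2, h1]
  rw [sub_eq_iff_eq_add', serW, PowerSeries.coeff_mk, hc]
  push_cast
  rfl

theorem series_zero (hw : Generic e w) (hk : kerW w = ⊤) : serW e ht w = 1 := by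
  classical
  have h0 : ∀ l, rv (e l) w = 0 := fun l => by
    rw [← castQ_mem_kerW, hk]; trivial
  have h1 : ∀ n, ∀ x ∈ conePts e ht w n, x = 0 := by
    intro n x hx
    ext j
    have := hw.vanish (x := x) (fun l => (hx.2 l).2) (φ := Pi.single j 1) (by rw [hk]; trivial)
    simpa [castQ] using this
  ext n
  rw [serW, PowerSeries.coeff_mk, PowerSeries.coeff_one]
  split_ifs with hn
  · subst hn
    have : conePts e ht w ((0 : ℕ) : ℤ) = {0} := by
      ext x
      constructor
      · exact h1 _ x
      · rintro rfl
        exact ⟨by simp, fun l => by simp [h0 l]⟩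
    rw [this]; simp
  · have : conePts e ht w (n : ℤ) = ∅ := by
      ext x
      simp only [Set.mem_empty_iff_false, iff_false]
      intro hx
      have := h1 _ x hx
      subst this
      have := hx.1
      simp at this
      omega
    rw [this]; simp

theorem reflect_sum' {α : Type} (s : Finset α) (f : α → ℤ[X]) (N : ℕ) :
    (∑ a ∈ s, f a).reflect N = ∑ a ∈ s, (f a).reflect N := by
  classical
  induction s using Finset.induction_on with
  | empty => simp
  | insert a s ha ih => rw [Finset.sum_insert ha, Finset.sum_insert ha, reflect_add, ih]

theorem reflect_succ_X_mul (p : ℤ[X]) {d : ℕ} (hp : p.natDegree ≤ d) :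
    (Polynomial.X * p).reflect (d + 1) = p.reflect d := by
  have := Polynomial.reflect_mul (Polynomial.X : ℤ[X]) p (F := 1) (G := d) (by simp) hp
  rw [add_comm, this]; simp

theorem reflect_succ_self (p : ℤ[X]) {d : ℕ} (hp : p.natDegree ≤ d) :
    p.reflect (d + 1) = Polynomial.X * p.reflect d := by
  have := Polynomial.reflect_mul (1 : ℤ[X]) p (F := 1) (G := d) (by simp) hp
  rw [one_mul] at this
  rw [add_comm, this]; simp

theorem cone_reciprocity
    (hfin : ∀ (w : σ → ℝ) n, (conePts e ht w n).Finite)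
    (hneg : ∀ (w : σ → ℝ) n, n < 0 → conePts e ht w n = ∅)
    (hV : ∀ w : σ → ℝ, w ≠ 0 → (∀ l, 0 ≤ rv (e l) w) → ∃ v, GoodV e ht w v) :
    ∀ (d : ℕ) (w : σ → ℝ), Generic e w → Module.finrank ℚ (kerW w) + d = Fintype.card σ →
      ∃ h : ℤ[X], h.natDegree ≤ d ∧
        (1 - PowerSeries.X) ^ d * serW e ht w = (h : PowerSeries ℤ) ∧
        (1 - PowerSeries.X) ^ d * serW e ht (-w) = (h.reflect d : PowerSeries ℤ) := by
  intro d
  induction d with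
  | zero =>
    intro w hw hd
    have hk : kerW w = ⊤ := by
      apply Submodule.eq_top_of_finrank_eq
      simpa using hd
    refine ⟨1, by simp, ?_, ?_⟩
    · rw [series_zero hw hk]; simp
    · rw [series_zero hw.neg (by rw [kerW_neg, hk])]; simp
  | succ d ih =>
    intro w hw hd
    by_cases hex : ∃ v, GoodV e ht w v
    · obtain ⟨v, hv⟩ := hex
      have key : ∀ c, ∃ h : ℤ[X], c ∈ vals e w v → (h.natDegree ≤ d ∧
        (1 - PowerSeries.X) ^ d * serW e ht (shiftDir w v c) = (h : PowerSeries ℤ) ∧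
        (1 - PowerSeries.X) ^ d * serW e ht (-(shiftDir w v c)) =
          (h.reflect d : PowerSeries ℤ)) := by
        intro c
        by_cases hc : c ∈ vals e w v
        · obtain ⟨h, hh⟩ := ih (shiftDir w v c) (hw.shift hv hc)
            (by rw [finrank_shift hw hv hc]; omega)
          exact ⟨h, fun _ => hh⟩
        · exact ⟨0, fun h => absurd h hc⟩
      choose h hh using key
      refine ⟨∑ c ∈ vals e w v, if 0 < c then h c else Polynomial.X * h c, ?_, ?_, ?_⟩
      · apply Polynomial.natDegree_sum_le_of_forall_le
        intro c hc
        have := (hh c hc).1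
        split_ifs
        · omega
        · refine natDegree_mul_le.trans ?_
          simp; omega
      · rw [pow_succ, mul_assoc, series_step hw hv hfin hneg, Finset.mul_sum]
        rw [← Polynomial.coeToPowerSeries.ringHom_apply, map_sum]
        apply Finset.sum_congr rfl
        intro c hc
        obtain ⟨-, h2, -⟩ := hh c hc
        split_ifs
        · simp [h2]
        · rw [mul_left_comm, h2]; simp
      · rw [pow_succ, mul_assoc, series_step hw.neg hv.neg hfin hneg, Finset.mul_sum, vals_neg,
          Finset.sum_map, reflect_sum']
        rw [← Polynomial.coeToPowerSeries.ringHom_apply, map_sum]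
        apply Finset.sum_congr rfl
        intro c hc
        obtain ⟨h1, -, h3⟩ := hh c hc
        have hc0 := vals_ne_zero hv hc
        simp only [Equiv.coe_toEmbedding, Equiv.neg_apply, shiftDir_neg]
        rcases lt_or_gt_of_ne hc0 with hlt | hlt
        · rw [if_pos (by linarith), if_neg (by linarith), reflect_succ_X_mul _ h1, h3]
          simp
        · rw [if_neg (by linarith), if_pos hlt, reflect_succ_self _ h1, mul_left_comm, h3]
          simp
    · have hw0 : w ≠ 0 := by
        rintro rfl
        have : kerW (0 : σ → ℝ) = ⊤ := by
          rw [eq_top_iff]; intro φ _; simp [mem_kerW]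
        rw [this] at hd
        simp at hd
      have hemp : ∀ u : σ → ℝ, (u = w ∨ u = -w) → serW e ht u = 0 := by
        intro u hu
        have hu0 : u ≠ 0 := by rcases hu with rfl | rfl <;> simpa using hw0
        have hT : ∀ l, rv (e l) w = 0 → rv (e l) u = 0 := by
          intro l hl
          rcases hu with rfl | rfl
          · exact hl
          · rw [rv_neg, hl, neg_zero]
        ext n
        have : conePts e ht u (n : ℤ) = ∅ := by
          rw [Set.eq_empty_iff_forall_notMem]
          intro x hx
          apply hex
          by_cases hx0 : x = 0
          · subst hx0
            obtain ⟨v, hv⟩ := hV u hu0 (fun l => by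
              have := (hx.2 l).1
              simpa using this)
            exact ⟨v, hv.1, fun l => ⟨(hv.2 l).1, fun h0 => (hv.2 l).2 (hT l h0)⟩⟩
          · obtain ⟨v, hv⟩ := hV (fun j => (x j : ℝ)) (by
              intro h
              apply hx0
              ext j
              have := congrFun h j
              simpa using this) (fun l => by
              rw [rv_cast]
              have := (hx.2 l).1
              have h2 : 0 ≤ e l ⬝ᵥ x := by omega
              exact_mod_cast h2)
            refine ⟨v, hv.1, fun l => ⟨(hv.2 l).1, fun h0 => (hv.2 l).2 ?_⟩⟩
            rw [rv_cast, (hx.2 l).2 (hT l h0)]; simp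
        rw [serW, PowerSeries.coeff_mk, this]; simp
      refine ⟨0, by simp, ?_, ?_⟩
      · rw [hemp w (Or.inl rfl)]; simp
      · rw [hemp (-w) (Or.inr rfl)]; simp

end abs

section vertex

theorem exists_int_of_unimod {k r : ℕ} (E : Fin r → Finset (Fin k))
    (hunimod : TotUnimodular (incidenceMatrix E)) (p : Fin k → ℝ)
    (hinj : ∀ D : Fin k → ℝ, (∀ j, p j = 0 → D j = 0) →
      (∀ i, ∑ j ∈ E i, p j = 1 → ∑ j ∈ E i, D j = 0) → D = 0) :
    ∃ z : Fin k → ℤ, ∀ j, p j = z j := by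
  classical
  let J := {j : Fin k // p j ≠ 0}
  let I := {i : Fin r // ∑ j ∈ E i, p j = 1}
  let B : Matrix I J ℝ := Matrix.of fun i j => if j.1 ∈ E i.1 then 1 else 0
  have hsum : ∀ (D : Fin k → ℝ), (∀ j, p j = 0 → D j = 0) → ∀ i : Fin r,
      ∑ j ∈ E i, D j = ∑ j : J, (if j.1 ∈ E i then 1 else 0) * D j.1 := by
    intro D hD i
    have h1 : ∑ j ∈ E i, D j = ∑ j : Fin k, (if j ∈ E i then (1 : ℝ) else 0) * D j := by
      simp [ite_mul]
    have h2 : ∑ j ∈ Finset.univ.filter (fun j => p j ≠ 0), (if j ∈ E i then (1 : ℝ) else 0) * D j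
        = ∑ j : J, (if j.1 ∈ E i then (1 : ℝ) else 0) * D j.1 :=
      Finset.sum_subtype _ (by simp) _
    rw [h1, ← h2, Finset.sum_filter_of_ne]
    intro j _ hne h0
    exact hne (by rw [hD j h0, mul_zero])
  have hB : Function.Injective B.mulVec := by
    rw [← Matrix.coe_mulVecLin, ← LinearMap.ker_eq_bot, LinearMap.ker_eq_bot']
    intro δ hδ
    let D : Fin k → ℝ := fun j => if h : p j ≠ 0 then δ ⟨j, h⟩ else 0
    have hD0 : ∀ j, p j = 0 → D j = 0 := fun j hj => by simp [D, hj]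
    have hDJ : ∀ j : J, D j.1 = δ j := fun j => by simp [D, j.2]
    have hD : D = 0 := by
      apply hinj D hD0
      intro i hi
      rw [hsum D hD0]
      have := congrFun hδ ⟨i, hi⟩
      simp only [Matrix.mulVecLin_apply, Matrix.mulVec, dotProduct, B, Matrix.of_apply] at this
      simpa [hDJ] using this
    ext j
    rw [← hDJ, hD]; rfl
  -- rows span
  have hrk : B.rank = Fintype.card J := by
    rw [Matrix.rank, LinearMap.finrank_range_of_inj]
    · simp
    · rw [Matrix.coe_mulVecLin]; exact hB
  have hspan : Submodule.span ℝ (Set.range B.row) = ⊤ := by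
    apply Submodule.eq_top_of_finrank_eq
    rw [← Matrix.rank_eq_finrank_span_row, hrk]; simp
  obtain ⟨κ, a, ha, hsp, hli⟩ := exists_linearIndependent' ℝ B.row
  rw [hspan] at hsp
  have : Finite κ := Finite.of_injective a ha
  have := Fintype.ofFinite κ
  have hcard : Fintype.card κ = Fintype.card J := by
    have b := Module.Basis.mk hli hsp.ge
    have := Module.finrank_eq_card_basis b
    simpa using this.symm
  let n := Fintype.card J
  let ek : Fin n ≃ κ := (Fintype.equivFinOfCardEq hcard).symm
  let ej : Fin n ≃ J := (Fintype.equivFin J).symm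
  let f : Fin n → Fin r := fun x => (a (ek x)).1
  let g : Fin n → Fin k := fun x => (ej x).1
  have hf : Function.Injective f := Subtype.val_injective.comp (ha.comp ek.injective)
  have hg : Function.Injective g := Subtype.val_injective.comp ej.injective
  let Z : Matrix (Fin n) (Fin n) ℤ := Matrix.of fun x y => if g y ∈ E (f x) then 1 else 0
  have hZQ : (incidenceMatrix E).submatrix f g = Z.map (Int.castRingHom ℚ) := by
    ext x y; simp [incidenceMatrix, Z]
  have hZR : (Z.map (Int.castRingHom ℝ)).det ≠ 0 := by
    have h1 : LinearIndependent ℝ (Z.map (Int.castRingHom ℝ)).row := by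
      have h2 : LinearIndependent ℝ ((B.row ∘ a) ∘ ek) := hli.comp _ ek.injective
      have h3 := h2.map' (LinearEquiv.funCongrLeft ℝ ℝ ej).toLinearMap (LinearEquiv.ker _)
      have h4 : (Z.map (Int.castRingHom ℝ)).row =
          (LinearEquiv.funCongrLeft ℝ ℝ ej).toLinearMap ∘ ((B.row ∘ a) ∘ ek) := by
        funext x y
        show ((Z x y : ℤ) : ℝ) = B (a (ek x)) (ej y)
        simp [Z, B, f, g]
      rw [h4]; exact h3
    have := Matrix.linearIndependent_rows_iff_isUnit.1 h1
    rw [Matrix.isUnit_iff_isUnit_det] at this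
    exact this.ne_zero
  have hdet : Z.det * Z.det = 1 := by
    have h1 := hunimod n f g hf hg
    rw [hZQ, ← RingHom.mapMatrix_apply, ← RingHom.map_det] at h1
    rw [← RingHom.mapMatrix_apply, ← RingHom.map_det] at hZR
    simp only [eq_intCast] at h1 hZR
    have h0 : Z.det ≠ 0 := by exact_mod_cast hZR
    rcases h1 with h1 | h1 | h1
    · have : Z.det = -1 := by exact_mod_cast h1
      rw [this]; norm_num
    · exact absurd (by exact_mod_cast h1) h0
    · have : Z.det = 1 := by exact_mod_cast h1
      rw [this]; norm_num
  let q : Fin n → ℝ := fun y => p (g y)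
  have hq : (Z.map (Int.castRingHom ℝ)).mulVec q = 1 := by
    ext x
    have h1 := (a (ek x)).2
    rw [hsum p (fun _ h => h)] at h1
    rw [← ej.sum_comp] at h1
    simp only [Matrix.mulVec, dotProduct, Z, q, Matrix.map_apply, Matrix.of_apply, Pi.one_apply]
    rw [← h1]
    apply Finset.sum_congr rfl
    intro y _
    congr 1
    simp [f, g]
  let u : Fin n → ℤ := Z.det • (Z.adjugate.mulVec 1)
  have hu : ∀ y, q y = u y := by
    have h1 : (Z.adjugate.map (Int.castRingHom ℝ)).mulVec ((Z.map (Int.castRingHom ℝ)).mulVec q)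
        = (Z.det : ℝ) • q := by
      rw [Matrix.mulVec_mulVec, ← Matrix.map_mul, Matrix.adjugate_mul]
      have h5 : (Z.det • (1 : Matrix (Fin n) (Fin n) ℤ)).map (Int.castRingHom ℝ) =
          (Z.det : ℝ) • (1 : Matrix (Fin n) (Fin n) ℝ) := by
        ext x y
        simp only [Matrix.map_apply, Matrix.smul_apply, Matrix.one_apply, smul_eq_mul]
        split_ifs <;> simp
      rw [h5, Matrix.smul_mulVec, Matrix.one_mulVec]
    intro y
    rw [hq] at h1
    have h2 := congrFun h1 y
    simp only [Pi.smul_apply, smul_eq_mul] at h2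
    have h3 : (Z.det : ℝ) * Z.det = 1 := by exact_mod_cast hdet
    have h4 : q y = Z.det * (Z.det * q y) := by rw [← mul_assoc, h3, one_mul]
    rw [h4, ← h2]
    simp [u, Matrix.mulVec, dotProduct]
  refine ⟨fun j => if h : p j ≠ 0 then u (ej.symm ⟨j, h⟩) else 0, fun j => ?_⟩
  by_cases h : p j = 0
  · simp [h]
  · have := hu (ej.symm ⟨j, h⟩)
    simp only [q, g, Equiv.apply_symm_apply] at this
    simp [h, this]

theorem exists_vertex {k r : ℕ} (E : Fin r → Finset (Fin k))
    (hunimod : TotUnimodular (incidenceMatrix E)) (hcover : ∀ v : Fin k, ∃ i, v ∈ E i)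
    (m : Fin k → ℝ) (hm : ∀ j, 0 ≤ m j) (hmE : ∀ i, ∑ j ∈ E i, m j ≤ 1) :
    ∃ z : Fin k → ℤ, (∀ j, z j = 0 ∨ z j = 1) ∧ (∀ i, ∑ j ∈ E i, z j = 0 ∨ ∑ j ∈ E i, z j = 1) ∧
      (∀ j, m j = 0 → z j = 0) ∧ (∀ i, ∑ j ∈ E i, m j = 1 → ∑ j ∈ E i, z j = 1) := by
  classical
  let Q : Set (Fin k → ℝ) := {p | (∀ j, 0 ≤ p j) ∧ (∀ i, ∑ j ∈ E i, p j ≤ 1) ∧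
    (∀ j, m j = 0 → p j = 0) ∧ (∀ i, ∑ j ∈ E i, m j = 1 → ∑ j ∈ E i, p j = 1)}
  have hle1 : ∀ p ∈ Q, ∀ j, p j ≤ 1 := by
    intro p hp j
    obtain ⟨i, hi⟩ := hcover j
    exact (Finset.single_le_sum (fun j _ => hp.1 j) hi).trans (hp.2.1 i)
  have hclosed : IsClosed Q := by
    have : Q = (⋂ j, {p | 0 ≤ p j}) ∩ (⋂ i, {p | ∑ j ∈ E i, p j ≤ 1}) ∩
        (⋂ j, ⋂ (_ : m j = 0), {p | p j = 0}) ∩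
        (⋂ i, ⋂ (_ : ∑ j ∈ E i, m j = 1), {p | ∑ j ∈ E i, p j = 1}) := by
      ext p
      simp [Q, and_assoc]
    rw [this]
    refine IsClosed.inter (IsClosed.inter (IsClosed.inter ?_ ?_) ?_) ?_
    · exact isClosed_iInter fun j => isClosed_le continuous_const (by fun_prop)
    · exact isClosed_iInter fun j => isClosed_le (by fun_prop) continuous_const
    · exact isClosed_iInter fun j => isClosed_iInter fun _ =>
        isClosed_eq (by fun_prop) continuous_const
    · exact isClosed_iInter fun j => isClosed_iInter fun _ =>
        isClosed_eq (by fun_prop) continuous_const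
  have hcomp : IsCompact Q := by
    refine IsCompact.of_isClosed_subset (isCompact_Icc (a := (0 : Fin k → ℝ)) (b := 1)) hclosed ?_
    intro p hp
    exact ⟨fun j => hp.1 j, fun j => hle1 p hp j⟩
  obtain ⟨p, hp⟩ := hcomp.extremePoints_nonempty ⟨m, hm, hmE, fun _ h => h, fun _ h => h⟩
  rw [mem_extremePoints] at hp
  obtain ⟨hpQ, hext⟩ := hp
  obtain ⟨z, hz⟩ := exists_int_of_unimod E hunimod p (by
    intro D hD0 hDE
    have hev : ∀ D : Fin k → ℝ, (∀ j, p j = 0 → D j = 0) →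
        (∀ i, ∑ j ∈ E i, p j = 1 → ∑ j ∈ E i, D j = 0) →
        ∀ᶠ t in nhdsWithin (0 : ℝ) (Set.Ioi 0), (p + t • D) ∈ Q := by
      intro D hD0 hDE
      have e1 : ∀ j, ∀ᶠ t in nhds (0 : ℝ), 0 ≤ p j + t * D j := by
        intro j
        by_cases h : p j = 0
        · simp [h, hD0 j h]
        · have hlt : 0 < p j := lt_of_le_of_ne (hpQ.1 j) (Ne.symm h)
          have hc : Continuous fun t : ℝ => p j + t * D j := by fun_prop
          have := (hc.tendsto 0).eventually_const_lt (u := 0) (by simpa using hlt)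
          exact this.mono fun _ h => h.le
      have e2 : ∀ i, ∀ᶠ t in nhds (0 : ℝ), ∑ j ∈ E i, p j + t * ∑ j ∈ E i, D j ≤ 1 := by
        intro i
        by_cases h : ∑ j ∈ E i, p j = 1
        · simp [h, hDE i h]
        · have hlt : ∑ j ∈ E i, p j < 1 := lt_of_le_of_ne (hpQ.2.1 i) h
          have hc : Continuous fun t : ℝ => ∑ j ∈ E i, p j + t * ∑ j ∈ E i, D j := by fun_prop
          have := (hc.tendsto 0).eventually_lt_const (u := 1) (by simpa using hlt)
          exact this.mono fun _ h => h.le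
      have e3 := (Filter.eventually_all.2 e1).and (Filter.eventually_all.2 e2)
      refine (e3.filter_mono nhdsWithin_le_nhds).mono ?_
      rintro t ⟨h1, h2⟩
      have hs : ∀ i, ∑ j ∈ E i, (p + t • D) j = ∑ j ∈ E i, p j + t * ∑ j ∈ E i, D j := by
        intro i
        simp [Finset.sum_add_distrib, Finset.mul_sum]
      refine ⟨fun j => by simpa using h1 j, fun i => by rw [hs]; exact h2 i, fun j hj => ?_,
        fun i hi => ?_⟩
      · have := hpQ.2.2.1 j hj
        simp [this, hD0 j this]
      · have := hpQ.2.2.2 i hi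
        rw [hs, this, hDE i this]; simp
    have h1 := hev D hD0 hDE
    have h2 := hev (-D) (fun j hj => by simp [hD0 j hj]) (fun i hi => by simp [hDE i hi])
    obtain ⟨t, ⟨ha, hb⟩, ht⟩ := ((h1.and h2).and self_mem_nhdsWithin).exists
    have ht : 0 < t := ht
    have := (hext _ ha _ hb ⟨1/2, 1/2, by norm_num, by norm_num, by norm_num, by
      ext j; simp; ring⟩).1
    have h3 : t • D = 0 := by simpa using this
    exact (smul_eq_zero.1 h3).resolve_left ht.ne')
  have hzE : ∀ i, ∑ j ∈ E i, p j = ((∑ j ∈ E i, z j : ℤ) : ℝ) := by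
    intro i; push_cast; exact Finset.sum_congr rfl fun j _ => hz j
  refine ⟨z, fun j => ?_, fun i => ?_, fun j hj => ?_, fun i hi => ?_⟩
  · have h1 := hpQ.1 j
    have h2 := hle1 p hpQ j
    rw [hz] at h1 h2
    have h1 : 0 ≤ z j := by exact_mod_cast h1
    have h2 : z j ≤ 1 := by exact_mod_cast h2
    omega
  · have h1 : 0 ≤ ∑ j ∈ E i, p j := Finset.sum_nonneg fun j _ => hpQ.1 j
    have h2 := hpQ.2.1 i
    rw [hzE] at h1 h2
    have h1 : 0 ≤ ∑ j ∈ E i, z j := by exact_mod_cast h1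
    have h2 : ∑ j ∈ E i, z j ≤ 1 := by exact_mod_cast h2
    omega
  · have := hpQ.2.2.1 j hj
    rw [hz] at this
    exact_mod_cast this
  · have := hpQ.2.2.2 i hi
    rw [hzE] at this
    exact_mod_cast this

end vertex

section concrete

/-- facet functionals of the homogenized cone -/
def fc {k r : ℕ} (E : Fin r → Finset (Fin k)) : Fin k ⊕ Fin r → Option (Fin k) → ℤ
  | Sum.inl j => fun o => o.elim 0 (fun j' => if j' = j then 1 else 0)
  | Sum.inr i => fun o => o.elim 1 (fun j => if j ∈ E i then -1 else 0)

/-- the height functional -/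
def hgt (k : ℕ) : Option (Fin k) → ℤ := fun o => o.elim 1 (fun _ => 0)

variable {k r : ℕ} (E : Fin r → Finset (Fin k))

theorem hgt_dot (x : Option (Fin k) → ℤ) : hgt k ⬝ᵥ x = x none := by
  simp [hgt, dotProduct, Fintype.sum_option]

theorem fc_inl (x : Option (Fin k) → ℤ) (j : Fin k) : fc E (Sum.inl j) ⬝ᵥ x = x (some j) := by
  simp [fc, dotProduct, Fintype.sum_option]

theorem fc_inr (x : Option (Fin k) → ℤ) (i : Fin r) :
    fc E (Sum.inr i) ⬝ᵥ x = x none - ∑ j ∈ E i, x (some j) := by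
  simp [fc, dotProduct, Fintype.sum_option, ite_mul, Finset.sum_ite_mem, sub_eq_add_neg]

theorem rv_inl (w : Option (Fin k) → ℝ) (j : Fin k) : rv (fc E (Sum.inl j)) w = w (some j) := by
  simp [fc, rv, Fintype.sum_option]

theorem rv_inr (w : Option (Fin k) → ℝ) (i : Fin r) :
    rv (fc E (Sum.inr i)) w = w none - ∑ j ∈ E i, w (some j) := by
  simp [fc, rv, Fintype.sum_option, ite_mul, Finset.sum_ite_mem, sub_eq_add_neg, apply_ite]

theorem conePts_nonneg {w : Option (Fin k) → ℝ} {n : ℤ} {x : Option (Fin k) → ℤ}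
    (hx : x ∈ conePts (fc E) (hgt k) w n) :
    x none = n ∧ (∀ j, 0 ≤ x (some j)) ∧ ∀ i, ∑ j ∈ E i, x (some j) ≤ n := by
  obtain ⟨h1, h2⟩ := hx
  rw [hgt_dot] at h1
  refine ⟨h1, fun j => ?_, fun i => ?_⟩
  · have := (h2 (Sum.inl j)).1
    rw [fc_inl] at this
    omega
  · have := (h2 (Sum.inr i)).1
    rw [fc_inr] at this
    omega

theorem cone_fin (hcover : ∀ v : Fin k, ∃ i, v ∈ E i) (w : Option (Fin k) → ℝ) (n : ℤ) :
    (conePts (fc E) (hgt k) w n).Finite := by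
  refine (Set.finite_Icc (fun o : Option (Fin k) => o.elim n (fun _ => 0))
    (fun o : Option (Fin k) => o.elim n (fun _ => n))).subset ?_
  intro x hx
  obtain ⟨h1, h2, h3⟩ := conePts_nonneg E hx
  constructor
  · rintro (_ | j)
    · exact h1.ge
    · exact h2 j
  · rintro (_ | j)
    · exact h1.le
    · obtain ⟨i, hi⟩ := hcover j
      exact (Finset.single_le_sum (f := fun j => x (some j)) (fun j _ => h2 j) hi).trans (h3 i)

theorem cone_neg (i0 : Fin r) (w : Option (Fin k) → ℝ) (n : ℤ) (hn : n < 0) :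
    conePts (fc E) (hgt k) w n = ∅ := by
  rw [Set.eq_empty_iff_forall_notMem]
  intro x hx
  obtain ⟨h1, h2, h3⟩ := conePts_nonneg E hx
  have := Finset.sum_nonneg (s := E i0) (f := fun j => x (some j)) (fun j _ => h2 j)
  have := h3 i0
  omega

theorem cone_vertex (i0 : Fin r) (hcover : ∀ v : Fin k, ∃ i, v ∈ E i)
    (hunimod : TotUnimodular (incidenceMatrix E)) (w : Option (Fin k) → ℝ) (hw : w ≠ 0)
    (hpos : ∀ l, 0 ≤ rv (fc E l) w) : ∃ v, GoodV (fc E) (hgt k) w v := by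
  have h1 : ∀ j, 0 ≤ w (some j) := fun j => by rw [← rv_inl E w j]; exact hpos _
  have h2 : ∀ i, ∑ j ∈ E i, w (some j) ≤ w none := fun i => by
    have := hpos (Sum.inr i); rw [rv_inr] at this; linarith
  have h3 : ∀ j, w (some j) ≤ w none := fun j => by
    obtain ⟨i, hi⟩ := hcover j
    exact (Finset.single_le_sum (f := fun j => w (some j)) (fun j _ => h1 j) hi).trans (h2 i)
  have h0 : 0 ≤ w none := (Finset.sum_nonneg (fun j _ => h1 j)).trans (h2 i0)
  have hn : 0 < w none := by
    rcases h0.lt_or_eq with h | h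
    · exact h
    · exfalso; apply hw
      funext o
      rcases o with _ | j
      · exact h.symm
      · exact le_antisymm (by simpa [← h] using h3 j) (h1 j)
  obtain ⟨z, hz1, hz2, hz3, hz4⟩ := exists_vertex E hunimod hcover (fun j => w (some j) / w none)
    (fun j => div_nonneg (h1 j) h0) (fun i => by
      rw [← Finset.sum_div, div_le_one hn]; exact h2 i)
  refine ⟨fun o => o.elim 1 z, ?_, ?_⟩
  · rw [hgt_dot]; rfl
  · rintro (j | i)
    · rw [fc_inl, rv_inl]
      exact ⟨hz1 j, fun h => hz3 j (by simp [h])⟩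
    · rw [fc_inr, rv_inr]
      have := hz2 i
      simp only [Option.elim]
      refine ⟨by omega, fun h => ?_⟩
      rw [hz4 i (by rw [← Finset.sum_div, div_eq_one_iff_eq hn.ne']; linarith)]
      rfl

theorem exists_dir (k : ℕ) : ∃ w : Option (Fin k) → ℝ, LinearIndependent ℚ w ∧
    (∀ j, 0 < w (some j)) ∧ ∑ j, w (some j) < w none := by
  obtain ⟨u, hu⟩ : ∃ u : Option (Fin k) → ℝ, LinearIndependent ℚ u := by
    have h : Cardinal.lift.{0} (Cardinal.mk (Option (Fin k))) ≤ Module.rank ℚ ℝ := by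
      rw [Real.rank_rat_real]
      exact (Cardinal.lt_aleph0_of_finite _).le.trans Cardinal.aleph0_le_continuum
    let b := Module.Basis.ofVectorSpace ℚ ℝ
    rw [← b.mk_eq_rank''] at h
    simp only [Cardinal.lift_id] at h
    obtain ⟨f⟩ := h
    exact ⟨b ∘ f, b.linearIndependent.comp f f.injective⟩
  have hne : ∀ o, u o ≠ 0 := fun o => hu.ne_zero o
  have hex : ∀ (a c : ℝ) (x : ℝ), x ≠ 0 → a < c → 0 ≤ a → ∃ q : ℚ, q ≠ 0 ∧ a < q * x ∧ q * x < c := by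
    intro a c x hx hac ha
    rcases hx.lt_or_gt with h | h
    · obtain ⟨q, h1, h2⟩ := exists_rat_btwn (div_lt_div_of_neg_of_lt h hac)
      have h1' := (div_lt_iff_of_neg h).1 h1
      have h2' := (lt_div_iff_of_neg h).1 h2
      refine ⟨q, ?_, h2', h1'⟩
      rintro rfl
      simp at h2'; linarith
    · obtain ⟨q, h1, h2⟩ := exists_rat_btwn (div_lt_div_of_pos_right hac h)
      have h1' := (div_lt_iff₀ h).1 h1
      have h2' := (lt_div_iff₀ h).1 h2
      refine ⟨q, ?_, h1', h2'⟩
      rintro rfl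
      simp at h1'; linarith
  choose q hq0 hq1 hq2 using fun o : Option (Fin k) =>
    hex (o.elim (k : ℝ) fun _ => 0) (o.elim (k + 1 : ℝ) fun _ => 1) (u o) (hne o)
      (by cases o <;> simp) (by cases o <;> simp)
  refine ⟨fun o => q o * u o, ?_, fun j => ?_, ?_⟩
  · have := hu.units_smul (fun o => Units.mk0 (q o) (hq0 o))
    convert this using 1
    funext o
    simp [Units.smul_def, Rat.smul_def]
  · simpa using hq1 (some j)
  · calc ∑ j, (q (some j) * u (some j) : ℝ) ≤ ∑ j : Fin k, 1 :=
        Finset.sum_le_sum fun j _ => by simpa using (hq2 (some j)).le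
      _ = k := by simp
      _ < _ := by simpa using hq1 none

theorem conePts_pos {w : Option (Fin k) → ℝ} (hw : ∀ l, 0 < rv (fc E l) w) (n : ℤ) :
    conePts (fc E) (hgt k) w n = {x | x none = n ∧ ∀ l, 0 ≤ fc E l ⬝ᵥ x} := by
  ext x
  simp only [conePts, Set.mem_setOf_eq, hgt_dot]
  refine and_congr_right fun _ => forall_congr' fun l => ?_
  have := hw l
  constructor
  · rintro ⟨h, -⟩; omega
  · intro h
    exact ⟨h.lt_or_eq.imp id fun h => ⟨h.symm, this.le⟩, fun h' => absurd h' this.ne'⟩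

theorem conePts_neg {w : Option (Fin k) → ℝ} (hw : ∀ l, 0 < rv (fc E l) w) (n : ℤ) :
    conePts (fc E) (hgt k) (-w) n = {x | x none = n ∧ ∀ l, 0 < fc E l ⬝ᵥ x} := by
  ext x
  simp only [conePts, Set.mem_setOf_eq, hgt_dot, rv_neg]
  refine and_congr_right fun _ => forall_congr' fun l => ?_
  have := hw l
  constructor
  · rintro ⟨h | h, -⟩
    · exact h
    · linarith [h.2]
  · intro h
    exact ⟨Or.inl h, fun h' => absurd h' (by linarith)⟩

/-- the interior shift vector -/
def uvec (k s : ℕ) : Option (Fin k) → ℤ := fun o => o.elim (s + 1 : ℤ) (fun _ => 1)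

theorem fc_uvec {s : ℕ} (huniform : ∀ i, (E i).card = s) (l : Fin k ⊕ Fin r) :
    fc E l ⬝ᵥ uvec k s = 1 := by
  rcases l with j | i
  · rw [fc_inl]; rfl
  · rw [fc_inr]; simp [uvec, huniform]

theorem ncard_shift {s : ℕ} (huniform : ∀ i, (E i).card = s) {w : Option (Fin k) → ℝ}
    (hw : ∀ l, 0 < rv (fc E l) w) (n : ℤ) :
    (conePts (fc E) (hgt k) (-w) n).ncard = (conePts (fc E) (hgt k) w (n - (s + 1))).ncard := by
  rw [conePts_pos E hw, conePts_neg E hw]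
  symm
  refine Set.ncard_congr (fun x _ => x + uvec k s) ?_ ?_ ?_
  · rintro x ⟨h1, h2⟩
    refine ⟨by simp [h1, uvec], fun l => ?_⟩
    rw [dotProduct_add, fc_uvec E huniform]
    have := h2 l; omega
  · intro a b _ _ h
    exact add_right_cancel h
  · rintro x ⟨h1, h2⟩
    refine ⟨x - uvec k s, ⟨by simp [h1, uvec], fun l => ?_⟩, by simp⟩
    rw [dotProduct_sub, fc_uvec E huniform]
    have := h2 l; omega

theorem ehr_eq (hcover : ∀ v : Fin k, ∃ i, v ∈ E i) {w : Option (Fin k) → ℝ}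
    (hw : ∀ l, 0 < rv (fc E l) w) (n : ℕ) :
    ehr (hypergraphPolytope E) n = (conePts (fc E) (hgt k) w n).ncard := by
  have key : ∀ m : Fin k → ℤ, (fun i => (m i : ℝ)) ∈ (n : ℝ) • hypergraphPolytope E ↔
      (∀ j, 0 ≤ m j) ∧ ∀ i, ∑ j ∈ E i, m j ≤ n := by
    intro m
    rcases Nat.eq_zero_or_pos n with rfl | hn
    · have hne : (hypergraphPolytope E).Nonempty := ⟨0, by simp [hypergraphPolytope]⟩
      rw [Nat.cast_zero, Set.zero_smul_set hne, Set.mem_zero]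
      constructor
      · intro h
        have h' : ∀ j, m j = 0 := fun j => by
          have := congrFun h j; simpa using this
        simp [h']
      · rintro ⟨h1, h2⟩
        funext j
        obtain ⟨i, hi⟩ := hcover j
        have := (Finset.single_le_sum (f := m) (fun j _ => h1 j) hi).trans (h2 i)
        have := h1 j
        have : m j = 0 := by push_cast at *; omega
        simp [this]
    · have hn' : (0 : ℝ) < n := by exact_mod_cast hn
      rw [Set.mem_smul_set_iff_inv_smul_mem₀ hn'.ne']
      simp only [hypergraphPolytope, Set.mem_setOf_eq, Pi.smul_apply, smul_eq_mul]
      refine and_congr (forall_congr' fun j => ?_) (forall_congr' fun i => ?_)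
      · rw [mul_nonneg_iff_of_pos_left (inv_pos.2 hn')]
        exact Int.cast_nonneg_iff
      · rw [← Finset.mul_sum, inv_mul_le_iff₀ hn', mul_one]
        exact_mod_cast Iff.rfl
  rw [ehr, conePts_pos E hw]
  refine Set.ncard_congr (fun m _ o => o.elim (n : ℤ) m) ?_ ?_ ?_
  · intro m hm
    rw [Set.mem_setOf_eq, key] at hm
    refine ⟨rfl, ?_⟩
    rintro (j | i)
    · rw [fc_inl]; exact hm.1 j
    · rw [fc_inr]; have := hm.2 i; simp only [Option.elim]; omega
  · intro a b _ _ h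
    funext j
    exact congrFun h (some j)
  · rintro x ⟨h1, h2⟩
    refine ⟨fun j => x (some j), ?_, ?_⟩
    · rw [Set.mem_setOf_eq, key]
      refine ⟨fun j => ?_, fun i => ?_⟩
      · have := h2 (Sum.inl j); rwa [fc_inl] at this
      · have := h2 (Sum.inr i); rw [fc_inr] at this; omega
    · funext o
      rcases o with _ | j
      · exact h1.symm
      · rfl

theorem ehr_zero (hcover : ∀ v : Fin k, ∃ i, v ∈ E i) :
    ehr (hypergraphPolytope E) 0 = 1 := by
  have hne : (hypergraphPolytope E).Nonempty := ⟨0, by simp [hypergraphPolytope]⟩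
  rw [ehr, Nat.cast_zero, Set.zero_smul_set hne, Set.ncard_eq_one]
  refine ⟨0, ?_⟩
  ext m
  simp only [Set.mem_setOf_eq, Set.mem_zero, Set.mem_singleton_iff]
  constructor
  · intro h; funext j
    have := congrFun h j; simpa using this
  · rintro rfl; funext j; simp

theorem poly_pal {k s : ℕ} (h : ℤ[X]) (hs : s ≤ k) (hd : h.natDegree ≤ k + 1)
    (h0 : h.coeff 0 = 1) (hr : h.reflect (k + 1) = Polynomial.X ^ (s + 1) * h) :
    h.natDegree = k - s ∧ ∀ i ≤ k - s, h.coeff i = h.coeff (k - s - i) := by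
  have hc : ∀ i ≤ k + 1, h.coeff (k + 1 - i) = if s + 1 ≤ i then h.coeff (i - (s + 1)) else 0 := by
    intro i hi
    have := congrArg (fun p => p.coeff i) hr
    simpa [Polynomial.coeff_reflect, Polynomial.revAt_le hi, Polynomial.coeff_X_pow_mul'] using this
  refine ⟨le_antisymm ?_ ?_, ?_⟩
  · rw [Polynomial.natDegree_le_iff_coeff_eq_zero]
    intro N hN
    by_cases hN' : N ≤ k + 1
    · have := hc (k + 1 - N) (by omega)
      rwa [if_neg (by omega), Nat.sub_sub_self hN'] at this
    · exact Polynomial.coeff_eq_zero_of_natDegree_lt (by omega)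
  · apply Polynomial.le_natDegree_of_ne_zero
    have := hc (s + 1) (by omega)
    rw [if_pos le_rfl, Nat.sub_self, h0] at this
    rw [show k - s = k + 1 - (s + 1) by omega, this]
    exact one_ne_zero
  · intro i hi
    have := hc (k + 1 - i) (by omega)
    rw [if_pos (by omega), Nat.sub_sub_self (by omega)] at this
    rw [this]; congr 1; omega

end concrete

theorem stmt9 {k r s : ℕ} (E : Fin r → Finset (Fin k))
    (hsimple : HypSimple E) (hconn : HypConnected E)
    (hcover : ∀ v : Fin k, ∃ i, v ∈ E i)
    (huniform : ∀ i, (E i).card = s)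
    (hunimod : TotUnimodular (incidenceMatrix E)) :
    ∃ M : Polynomial ℤ,
      ((1 - PowerSeries.X) ^ (k + 1) : PowerSeries ℚ) * ehrSeries (hypergraphPolytope E) =
          ((M.map (Int.castRingHom ℚ) : Polynomial ℚ) : PowerSeries ℚ) ∧
        M.natDegree = k - s ∧
        ∀ i ≤ k - s, M.coeff i = M.coeff (k - s - i) := by
  rcases Nat.eq_zero_or_pos k with rfl | hk
  · refine ⟨1, ?_, by simp, fun i hi => ?_⟩
    · have h1 : ∀ n, ehr (hypergraphPolytope E) n = 1 := by
        intro n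
        rw [ehr, Set.ncard_eq_one]
        refine ⟨0, ?_⟩
        ext m
        simp only [Set.mem_setOf_eq, Set.mem_singleton_iff]
        refine ⟨fun _ => Subsingleton.elim _ _, fun _ => ?_⟩
        refine ⟨0, ⟨fun i => le_rfl, fun i => ?_⟩, Subsingleton.elim _ _⟩
        simp only [Pi.zero_apply, Finset.sum_const_zero]
        exact zero_le_one
      have h2 : ehrSeries (hypergraphPolytope E) = PowerSeries.mk 1 := by
        ext n; simp [ehrSeries, h1]
      rw [h2, mul_comm, zero_add, pow_one, PowerSeries.mk_one_mul_one_sub_eq_one]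
      simp
    · obtain rfl : i = 0 := by omega
      simp
  · obtain ⟨i0, hi0⟩ := hcover ⟨0, hk⟩
    have hsk : s ≤ k := by
      rw [← huniform i0]; simpa using Finset.card_le_univ (E i0)
    obtain ⟨w, hli, hw1, hw2⟩ := exists_dir k
    have hw : ∀ l, 0 < rv (fc E l) w := by
      rintro (j | i)
      · rw [rv_inl]; exact hw1 j
      · rw [rv_inr]
        have := Finset.sum_le_sum_of_subset_of_nonneg (Finset.subset_univ (E i))
          (f := fun j => w (some j)) (fun j _ _ => (hw1 j).le)
        linarith
    have hker : kerW w = ⊥ := by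
      rw [kerW, LinearMap.ker_eq_bot]
      exact hli.fintypeLinearCombination_injective
    have hgen : Generic (fc E) w := by
      rw [Generic, hker]; exact bot_le
    obtain ⟨h, hd, hh1, hh2⟩ := cone_reciprocity (e := fc E) (ht := hgt k)
      (fun w n => cone_fin E hcover w n) (fun w n hn => cone_neg E i0 w n hn)
      (fun w hw0 hp => cone_vertex E i0 hcover hunimod w hw0 hp) (k + 1) w hgen
      (by rw [hker]; simp)
    have hshift : serW (fc E) (hgt k) (-w) = PowerSeries.X ^ (s + 1) * serW (fc E) (hgt k) w := by
      ext n
      rw [PowerSeries.coeff_X_pow_mul']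
      simp only [serW, PowerSeries.coeff_mk]
      rw [ncard_shift E huniform hw]
      split_ifs with hn
      · rw [Nat.cast_sub hn]; push_cast; rfl
      · rw [cone_neg E i0 _ _ (by omega)]; simp
    have hr : h.reflect (k + 1) = Polynomial.X ^ (s + 1) * h := by
      apply Polynomial.coe_injective
      rw [← hh2, hshift, Polynomial.coe_mul, ← hh1]
      push_cast
      ring
    have h0 : h.coeff 0 = 1 := by
      rw [← Polynomial.coeff_coe, ← hh1]
      have := ehr_eq E hcover hw 0
      rw [ehr_zero E hcover] at this
      have h3 : (conePts (fc E) (hgt k) w 0).ncard = 1 := this.symm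
      rw [PowerSeries.coeff_zero_eq_constantCoeff_apply, map_mul]
      have h4 : PowerSeries.constantCoeff (serW (fc E) (hgt k) w) = 1 := by
        rw [← PowerSeries.coeff_zero_eq_constantCoeff_apply, serW, PowerSeries.coeff_mk]
        exact_mod_cast congrArg (Nat.cast (R := ℤ)) h3
      rw [h4]
      simp
    obtain ⟨p1, p2⟩ := poly_pal h hsk hd h0 hr
    refine ⟨h, ?_, p1, p2⟩
    have := congrArg (PowerSeries.map (Int.castRingHom ℚ)) hh1
    rw [map_mul, map_pow, map_sub, map_one, PowerSeries.map_X] at this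
    have hs : ehrSeries (hypergraphPolytope E) =
        PowerSeries.map (Int.castRingHom ℚ) (serW (fc E) (hgt k) w) := by
      ext n
      simp [ehrSeries, serW, ehr_eq E hcover hw]
    rw [hs, this, Polynomial.polynomial_map_coe]
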